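/- Let γ, σ² : [0,1] → ℝ be continuous with σ²(u) > 0 for all u ∈ [0,1] (condition (UE)), let Γ(u) := ∫₀^u γ(v) dv, g := ∫₀¹ γ(v) dv, assume (E1): Γ(u) − g·u > 0 for all u ∈ (0,1), let Ψ(u) := ∫_{1/2}^u σ²(v)/(2(Γ(v) − g·v)) dv and p_c := 2(g − γ(1))/σ²(1), and suppose p_c > 0. Then for every continuous function f : [0,1] → ℝ, the function p ↦ ⟨f, Π̄^p⟩ := (∫₀¹ f(u)·exp(p·Ψ(u)) du)/(∫₀¹ exp(p·Ψ(u)) du) is well defined and continuous on [0, p_c). -/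

import Mathlib

open MeasureTheory Set Filter Topology

/-- `Γ(u) = ∫₀^u γ(v) dv`. -/
noncomputable def Gam (γ : ℝ → ℝ) (u : ℝ) : ℝ := ∫ v in (0:ℝ)..u, γ v

/-- market mean growth rate `g = ∫₀¹ γ(v) dv`. -/
noncomputable def mg (γ : ℝ → ℝ) : ℝ := ∫ v in (0:ℝ)..1, γ v

/-- `Ψ(u) = ∫_{1/2}^u σ²(v) / (2 (Γ(v) - g v)) dv`. -/
noncomputable def Psi (γ σ2 : ℝ → ℝ) (u : ℝ) : ℝ :=
  ∫ v in (1/2:ℝ)..u, σ2 v / (2 * (Gam γ v - mg γ * v))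

/-- critical diversity index `p_c = 2 (g - γ(1)) / σ²(1)`. -/
noncomputable def pcrit (γ σ2 : ℝ → ℝ) : ℝ := 2 * (mg γ - γ 1) / σ2 1

/-- critical index `q_c = 2 (γ(0) - g) / σ²(0)`. -/
noncomputable def qcrit (γ σ2 : ℝ → ℝ) : ℝ := 2 * (γ 0 - mg γ) / σ2 0

/-- `⟨f, Π̄^p⟩ = (∫₀¹ f(u) exp(p Ψ(u)) du) / (∫₀¹ exp(p Ψ(u)) du)`. -/
noncomputable def bracket (γ σ2 f : ℝ → ℝ) (p : ℝ) : ℝ :=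
  (∫ u in Set.Ioo (0:ℝ) 1, f u * Real.exp (p * Psi γ σ2 u)) /
    ∫ u in Set.Ioo (0:ℝ) 1, Real.exp (p * Psi γ σ2 u)

lemma gam_ext (γ : ℝ → ℝ) (hγc : ContinuousOn γ (Set.Icc 0 1)) :
    ∃ G : ℝ → ℝ, (∀ u ∈ Icc (0:ℝ) 1, Gam γ u = G u) ∧ Continuous G ∧ HasDerivAt G (γ 1) 1 := by
  let γ' : ℝ → ℝ := IccExtend (zero_le_one (α := ℝ)) ((Icc (0:ℝ) 1).domRestrict γ)
  have hc : Continuous γ' := (continuousOn_iff_continuous_domRestrict.1 hγc).Icc_extend'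
  have he : ∀ u ∈ Icc (0:ℝ) 1, γ' u = γ u := fun u hu => by
    simp only [γ']; rw [IccExtend_of_mem _ _ hu]; rfl
  have hd : ∀ u, HasDerivAt (fun u => ∫ v in (0:ℝ)..u, γ' v) (γ' u) u := fun u =>
    intervalIntegral.integral_hasDerivAt_right (hc.intervalIntegrable _ _)
      hc.aestronglyMeasurable.stronglyMeasurableAtFilter hc.continuousAt
  refine ⟨fun u => ∫ v in (0:ℝ)..u, γ' v, ?_, ?_, ?_⟩
  · intro u hu
    refine intervalIntegral.integral_congr fun v hv => ?_
    rw [uIcc_of_le hu.1] at hv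
    exact (he v ⟨hv.1, hv.2.trans hu.2⟩).symm
  · exact continuous_iff_continuousAt.2 fun u => (hd u).continuousAt
  · rw [← he 1 (by simp)]; exact hd 1

lemma phi_cont (γ σ2 : ℝ → ℝ) (hγc : ContinuousOn γ (Set.Icc 0 1))
    (hσc : ContinuousOn σ2 (Set.Icc 0 1))
    (hE1 : ∀ u ∈ Set.Ioo (0:ℝ) 1, 0 < Gam γ u - mg γ * u) :
    ContinuousOn (fun v => σ2 v / (2 * (Gam γ v - mg γ * v))) (Ioo 0 1) := by
  obtain ⟨G, hG, hGc, -⟩ := gam_ext γ hγc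
  have : ContinuousOn (Gam γ) (Ioo 0 1) :=
    hGc.continuousOn.congr fun u hu => hG u (Ioo_subset_Icc_self hu)
  refine (hσc.mono Ioo_subset_Icc_self).div (by fun_prop) fun v hv => ?_
  have := hE1 v hv
  positivity

lemma psi_deriv (γ σ2 : ℝ → ℝ) (hγc : ContinuousOn γ (Set.Icc 0 1))
    (hσc : ContinuousOn σ2 (Set.Icc 0 1))
    (hE1 : ∀ u ∈ Set.Ioo (0:ℝ) 1, 0 < Gam γ u - mg γ * u) (u : ℝ) (hu : u ∈ Ioo (0:ℝ) 1) :
    HasDerivAt (Psi γ σ2) (σ2 u / (2 * (Gam γ u - mg γ * u))) u := by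
  have hc := phi_cont γ σ2 hγc hσc hE1
  refine intervalIntegral.integral_hasDerivAt_right ?_
    (hc.stronglyMeasurableAtFilter isOpen_Ioo u hu) (hc.continuousAt (isOpen_Ioo.mem_nhds hu))
  refine (hc.mono ?_).intervalIntegrable
  exact ordConnected_Ioo.uIcc_subset (by norm_num) hu

lemma phi_bound (γ σ2 : ℝ → ℝ) (hγc : ContinuousOn γ (Set.Icc 0 1))
    (hσc : ContinuousOn σ2 (Set.Icc 0 1)) (hUE : ∀ u ∈ Set.Icc (0:ℝ) 1, 0 < σ2 u)
    (hpc : 0 < pcrit γ σ2) (q : ℝ) (hq : 0 < q) (hqp : q < pcrit γ σ2) :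
    ∃ a ∈ Ioo (0:ℝ) 1, ∀ v ∈ Ioo a 1,
      σ2 v / (2 * (Gam γ v - mg γ * v)) ≤ (1/q) / (1 - v) := by
  obtain ⟨G, hG, hGc, hGd⟩ := gam_ext γ hγc
  have h1 : 0 < σ2 1 := hUE 1 (by simp)
  have hD : 0 < mg γ - γ 1 := by
    unfold pcrit at hpc
    have := (div_pos_iff_of_pos_right h1).1 hpc
    linarith
  have hG1 : G 1 = mg γ := (hG 1 (by simp)).symm
  have hd : HasDerivAt (fun v => G v - mg γ * v) (γ 1 - mg γ) 1 := by
    have h := hGd.fun_sub ((hasDerivAt_id' (1:ℝ)).const_mul (mg γ))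
    rwa [mul_one] at h
  have hs := (hasDerivAt_iff_tendsto_slope.1 hd).mono_left
    (nhdsWithin_mono (1:ℝ) (s := Iio 1) (fun x hx => ne_of_lt hx))
  have hσ : Tendsto σ2 (𝓝[<] 1) (𝓝 (σ2 1)) := by
    have := hσc 1 (by simp)
    refine (this.mono_left ?_)
    rw [← nhdsWithin_Ioo_eq_nhdsLT (zero_lt_one (α := ℝ))]
    exact nhdsWithin_mono _ Ioo_subset_Icc_self
  have hlim := hσ.div (hs.const_mul (-2)) (by nlinarith)
  have hlt : σ2 1 / (-2 * (γ 1 - mg γ)) < 1 / q := by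
    unfold pcrit at hqp
    rw [lt_div_iff₀ h1] at hqp
    rw [div_lt_div_iff₀ (by nlinarith) hq]
    nlinarith
  have hev := (hlim.eventually (gt_mem_nhds hlt))
  have hev2 : ∀ᶠ v in 𝓝[<] (1:ℝ), v ∈ Ioo (0:ℝ) 1 := Ioo_mem_nhdsLT zero_lt_one
  obtain ⟨a, ha, hsub⟩ := (mem_nhdsLT_iff_exists_Ioo_subset' (zero_lt_one (α := ℝ))).1 (hev.and hev2)
  have ha' : a < 1 := ha
  refine ⟨max a (1/2), ⟨by positivity, max_lt ha' (by norm_num)⟩, fun v hv => ?_⟩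
  obtain ⟨k1, k2⟩ := hsub ⟨(le_max_left _ _).trans_lt hv.1, hv.2⟩
  rw [hG v (Ioo_subset_Icc_self k2)]
  have k3 : 0 < 1 - v := by linarith [k2.2]
  rw [le_div_iff₀ k3]
  refine le_of_eq_of_le ?_ k1.le
  simp only [Pi.div_apply, slope_def_field, hG1]
  have : v - 1 ≠ 0 := by linarith
  have e : -2 * ((G v - mg γ * v - (mg γ - mg γ * 1)) / (v - 1))
      = (2 * (G v - mg γ * v)) / (1 - v) := by
    have := k3.ne'
    rw [show v - 1 = -(1 - v) by ring, div_neg]; ring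
  rw [e, div_div_eq_mul_div, div_mul_eq_mul_div]

lemma psi_bound (γ σ2 : ℝ → ℝ) (hγc : ContinuousOn γ (Set.Icc 0 1))
    (hσc : ContinuousOn σ2 (Set.Icc 0 1)) (hUE : ∀ u ∈ Set.Icc (0:ℝ) 1, 0 < σ2 u)
    (hE1 : ∀ u ∈ Set.Ioo (0:ℝ) 1, 0 < Gam γ u - mg γ * u)
    (hpc : 0 < pcrit γ σ2) (q : ℝ) (hq : 0 < q) (hqp : q < pcrit γ σ2) :
    ∃ M, ∀ u ∈ Ioo (0:ℝ) 1, Psi γ σ2 u ≤ M - (1/q) * Real.log (1 - u) := by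
  obtain ⟨a, ha, hb⟩ := phi_bound γ σ2 hγc hσc hUE hpc q hq hqp
  have hd := psi_deriv γ σ2 hγc hσc hE1
  have hlog : ∀ u ∈ Ioo (0:ℝ) 1, (1/q) * Real.log (1 - u) ≤ 0 := fun u hu =>
    mul_nonpos_of_nonneg_of_nonpos (by positivity)
      (Real.log_nonpos (by linarith [hu.2]) (by linarith [hu.1]))
  have hmono : MonotoneOn (Psi γ σ2) (Ioo 0 1) := by
    refine monotoneOn_of_deriv_nonneg (convex_Ioo 0 1)
      (fun u hu => (hd u hu).continuousAt.continuousWithinAt) ?_ ?_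
    · rw [interior_Ioo]
      exact fun u hu => (hd u hu).differentiableAt.differentiableWithinAt
    · rw [interior_Ioo]
      intro u hu
      rw [(hd u hu).deriv]
      have := hE1 u hu
      have := hUE u (Ioo_subset_Icc_self hu)
      positivity
  have hd2 : ∀ u ∈ Ioo (0:ℝ) 1, HasDerivAt (fun u => Psi γ σ2 u + (1/q) * Real.log (1 - u))
      (σ2 u / (2 * (Gam γ u - mg γ * u)) - (1/q) / (1 - u)) u := by
    intro u hu
    have h1 : (1 - u) ≠ 0 := by linarith [hu.2]
    have := (hd u hu).fun_add ((((hasDerivAt_id' u).const_sub 1).log h1).const_mul (1/q))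
    refine this.congr_deriv ?_
    ring
  have hanti : AntitoneOn (fun u => Psi γ σ2 u + (1/q) * Real.log (1 - u)) (Ico a 1) := by
    have hsub : ∀ u ∈ Ico a 1, u ∈ Ioo (0:ℝ) 1 := fun u hu => ⟨ha.1.trans_le hu.1, hu.2⟩
    refine antitoneOn_of_deriv_nonpos (convex_Ico a 1)
      (fun u hu => (hd2 u (hsub u hu)).continuousAt.continuousWithinAt) ?_ ?_
    · rw [interior_Ico]
      exact fun u hu => (hd2 u (hsub u ⟨hu.1.le, hu.2⟩)).differentiableAt.differentiableWithinAt
    · rw [interior_Ico]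
      intro u hu
      rw [(hd2 u (hsub u ⟨hu.1.le, hu.2⟩)).deriv]
      linarith [hb u hu]
  refine ⟨Psi γ σ2 a, fun u hu => ?_⟩
  rcases le_total u a with h | h
  · linarith [hmono hu ha h, hlog u hu]
  · have := hanti ⟨le_rfl, ha.2⟩ ⟨h, hu.2⟩ h
    simp only at this
    linarith [hlog a ha]

lemma meas_exp (γ σ2 : ℝ → ℝ) (hγc : ContinuousOn γ (Set.Icc 0 1))
    (hσc : ContinuousOn σ2 (Set.Icc 0 1))
    (hE1 : ∀ u ∈ Set.Ioo (0:ℝ) 1, 0 < Gam γ u - mg γ * u) (p : ℝ) :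
    ContinuousOn (fun u => Real.exp (p * Psi γ σ2 u)) (Ioo 0 1) := by
  have : ContinuousOn (Psi γ σ2) (Ioo 0 1) := fun u hu =>
    (psi_deriv γ σ2 hγc hσc hE1 u hu).continuousAt.continuousWithinAt
  fun_prop

lemma integ_exp (γ σ2 : ℝ → ℝ) (hγc : ContinuousOn γ (Set.Icc 0 1))
    (hσc : ContinuousOn σ2 (Set.Icc 0 1)) (hUE : ∀ u ∈ Set.Icc (0:ℝ) 1, 0 < σ2 u)
    (hE1 : ∀ u ∈ Set.Ioo (0:ℝ) 1, 0 < Gam γ u - mg γ * u)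
    (hpc : 0 < pcrit γ σ2) (p : ℝ) (hp : p ∈ Set.Ico (0:ℝ) (pcrit γ σ2)) :
    IntegrableOn (fun u => Real.exp (p * Psi γ σ2 u)) (Set.Ioo 0 1) := by
  obtain ⟨hp0, hp1⟩ := hp
  obtain ⟨q, hpq, hqc⟩ := exists_between hp1
  have hq : 0 < q := hp0.trans_lt hpq
  obtain ⟨M, hM⟩ := psi_bound γ σ2 hγc hσc hUE hE1 hpc q hq hqc
  have hi : IntegrableOn (fun u : ℝ => Real.exp (p * M) * (1 - u) ^ (-(p / q))) (Ioo 0 1) := by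
    have h1 : -1 < -(p / q) := by
      have := (div_lt_one hq).2 hpq
      linarith
    have h2 := (intervalIntegral.intervalIntegrable_rpow' (a := 1) (b := 0) h1).comp_sub_left 1
    simp only [sub_self, sub_zero] at h2
    have h3 := (intervalIntegrable_iff_integrableOn_Ioo_of_le zero_le_one).1 h2
    exact h3.const_mul _
  refine Integrable.mono' hi
    ((meas_exp γ σ2 hγc hσc hE1 p).aestronglyMeasurable measurableSet_Ioo) ?_
  refine (ae_restrict_iff' measurableSet_Ioo).2 (Eventually.of_forall fun u hu => ?_)
  have h1 : 0 < 1 - u := by linarith [hu.2]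
  rw [Real.norm_eq_abs, abs_of_pos (Real.exp_pos _), Real.rpow_def_of_pos h1, ← Real.exp_add]
  refine Real.exp_le_exp.2 ((mul_le_mul_of_nonneg_left (hM u hu) hp0).trans_eq ?_)
  ring

lemma cont_num (γ σ2 : ℝ → ℝ) (hγc : ContinuousOn γ (Set.Icc 0 1))
    (hσc : ContinuousOn σ2 (Set.Icc 0 1)) (hUE : ∀ u ∈ Set.Icc (0:ℝ) 1, 0 < σ2 u)
    (hE1 : ∀ u ∈ Set.Ioo (0:ℝ) 1, 0 < Gam γ u - mg γ * u)
    (hpc : 0 < pcrit γ σ2)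
    (f : ℝ → ℝ) (hf : ContinuousOn f (Set.Icc 0 1)) :
    ContinuousOn (fun p => ∫ u in Set.Ioo (0:ℝ) 1, f u * Real.exp (p * Psi γ σ2 u))
      (Set.Ico 0 (pcrit γ σ2)) := by
  obtain ⟨C, hC⟩ := isCompact_Icc.exists_bound_of_continuousOn hf
  intro p hp
  obtain ⟨q, hpq, hqc⟩ := exists_between hp.2
  have hq : 0 < q := hp.1.trans_lt hpq
  have hi := integ_exp γ σ2 hγc hσc hUE hE1 hpc q ⟨hq.le, hqc⟩
  refine continuousWithinAt_of_dominated
    (bound := fun u => C * (1 + Real.exp (q * Psi γ σ2 u))) ?_ ?_ ?_ ?_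
  · exact Eventually.of_forall fun p => ((hf.mono Ioo_subset_Icc_self).mul
      (meas_exp γ σ2 hγc hσc hE1 p)).aestronglyMeasurable measurableSet_Ioo
  · have e1 : ∀ᶠ x in 𝓝[Ico 0 (pcrit γ σ2)] p, x < q :=
      eventually_nhdsWithin_of_eventually_nhds (gt_mem_nhds hpq)
    filter_upwards [e1, self_mem_nhdsWithin] with x hx hx0
    refine (ae_restrict_iff' measurableSet_Ioo).2 (Eventually.of_forall fun u hu => ?_)
    rw [norm_mul, Real.norm_eq_abs (Real.exp _), abs_of_pos (Real.exp_pos _)]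
    have hCu := hC u (Ioo_subset_Icc_self hu)
    refine mul_le_mul hCu ?_ (Real.exp_pos _).le ((norm_nonneg _).trans hCu)
    rcases le_total 0 (Psi γ σ2 u) with h | h
    · have := Real.exp_le_exp.2 (mul_le_mul_of_nonneg_right hx.le h)
      linarith
    · have := Real.exp_le_one_iff.2 (mul_nonpos_of_nonneg_of_nonpos hx0.1 h)
      linarith [Real.exp_pos (q * Psi γ σ2 u)]
  · refine Integrable.const_mul (Integrable.add ?_ hi) C
    exact integrable_const _
  · refine Eventually.of_forall fun u => ?_
    exact Continuous.continuousWithinAt (by fun_prop)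

/-- under (UE), (E1) and p_c > 0, for every continuous f : [0,1] → ℝ,
the map p ↦ ⟨f, Π̄^p⟩ is well defined (the normalizing integral is finite) and
continuous on [0, p_c). -/
theorem stmt9 (γ σ2 : ℝ → ℝ) (hγc : ContinuousOn γ (Set.Icc 0 1))
    (hσc : ContinuousOn σ2 (Set.Icc 0 1)) (hUE : ∀ u ∈ Set.Icc (0:ℝ) 1, 0 < σ2 u)
    (hE1 : ∀ u ∈ Set.Ioo (0:ℝ) 1, 0 < Gam γ u - mg γ * u)
    (hpc : 0 < pcrit γ σ2)
    (f : ℝ → ℝ) (hf : ContinuousOn f (Set.Icc 0 1)) :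
    (∀ p ∈ Set.Ico (0:ℝ) (pcrit γ σ2),
        IntegrableOn (fun u => Real.exp (p * Psi γ σ2 u)) (Set.Ioo 0 1)) ∧
      ContinuousOn (bracket γ σ2 f) (Set.Ico 0 (pcrit γ σ2)) := by
  have hint := integ_exp γ σ2 hγc hσc hUE hE1 hpc
  refine ⟨hint, ?_⟩
  refine (cont_num γ σ2 hγc hσc hUE hE1 hpc f hf).div ?_ fun p hp => ?_
  · simpa using cont_num γ σ2 hγc hσc hUE hE1 hpc (fun _ => 1) continuousOn_const
  · refine ne_of_gt ?_
    haveI : NeZero ((volume : Measure ℝ).restrict (Ioo (0:ℝ) 1)) := ⟨by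
      rw [Ne, Measure.restrict_eq_zero]; simp⟩
    exact integral_exp_pos (hint p hp)
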